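/- arXiv:1910.10867 — 3 statements merged into one kernel-verified Lean document; each statement's English description precedes it below -/
import Mathlib

section
/- Let h ≥ 1 and let λ_1, …, λ_h be distinct complex numbers, none of which is an invariant zero of (A,B,C,D). Then dim(W(λ_1) + W(λ_2) + ⋯ + W(λ_h)) = dim(𝒱* ∩ 𝒮_h). -/
open Matrix Submodule

/-- The Rosenbrock matrix `[[A - λI, B], [C, D]]`. -/
noncomputable def rosenbrock {n m p : ℕ} (A : Matrix (Fin n) (Fin n) ℂ)
    (B : Matrix (Fin n) (Fin m) ℂ) (C : Matrix (Fin p) (Fin n) ℂ)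
    (D : Matrix (Fin p) (Fin m) ℂ) (lam : ℂ) :
    Matrix (Fin n ⊕ Fin p) (Fin n ⊕ Fin m) ℂ :=
  Matrix.fromBlocks (A - lam • 1) B C D

/-- `λ` is an invariant zero of `(A,B,C,D)` if the rank of the Rosenbrock matrix at `λ`
is strictly smaller than its normal rank (the max over `μ` of the rank at `μ`). -/
noncomputable def IsInvariantZero {n m p : ℕ} (A : Matrix (Fin n) (Fin n) ℂ)
    (B : Matrix (Fin n) (Fin m) ℂ) (C : Matrix (Fin p) (Fin n) ℂ)
    (D : Matrix (Fin p) (Fin m) ℂ) (lam : ℂ) : Prop :=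
  (rosenbrock A B C D lam).rank < ⨆ μ : ℂ, (rosenbrock A B C D μ).rank

/-- The Rosenbrock pencil subspace `W(λ) = {x | ∃ u, (A - λI)x + Bu = 0 ∧ Cx + Du = 0}`. -/
noncomputable def rosSub {n m p : ℕ} (A : Matrix (Fin n) (Fin n) ℂ)
    (B : Matrix (Fin n) (Fin m) ℂ) (C : Matrix (Fin p) (Fin n) ℂ)
    (D : Matrix (Fin p) (Fin m) ℂ) (lam : ℂ) : Submodule ℂ (Fin n → ℂ) :=
  Submodule.map (LinearMap.fst ℂ (Fin n → ℂ) (Fin m → ℂ))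
    (LinearMap.ker ((((A - lam • 1).mulVecLin).coprod B.mulVecLin).prod
      ((C.mulVecLin).coprod D.mulVecLin)))

/-- A subspace `𝒱` is output-nulling if it has a friend `F`, i.e.
`(A + BF) 𝒱 ⊆ 𝒱` and `𝒱 ⊆ ker (C + DF)`. -/
def IsOutputNulling {n m p : ℕ} (A : Matrix (Fin n) (Fin n) ℂ)
    (B : Matrix (Fin n) (Fin m) ℂ) (C : Matrix (Fin p) (Fin n) ℂ)
    (D : Matrix (Fin p) (Fin m) ℂ) (V : Submodule ℂ (Fin n → ℂ)) : Prop :=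
  ∃ F : Matrix (Fin m) (Fin n) ℂ,
    (∀ x ∈ V, (A + B * F).mulVecLin x ∈ V) ∧ V ≤ LinearMap.ker (C + D * F).mulVecLin

/-- The largest output-nulling subspace `𝒱*`. -/
noncomputable def vStar {n m p : ℕ} (A : Matrix (Fin n) (Fin n) ℂ)
    (B : Matrix (Fin n) (Fin m) ℂ) (C : Matrix (Fin p) (Fin n) ℂ)
    (D : Matrix (Fin p) (Fin m) ℂ) : Submodule ℂ (Fin n → ℂ) :=
  sSup {V : Submodule ℂ (Fin n → ℂ) | IsOutputNulling A B C D V}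

/-- The input-containing sequence: `𝒮_0 = 0`,
`𝒮_{j+1} = {Ax + Bu : x ∈ 𝒮_j, Cx + Du = 0}`. -/
noncomputable def sSeq {n m p : ℕ} (A : Matrix (Fin n) (Fin n) ℂ)
    (B : Matrix (Fin n) (Fin m) ℂ) (C : Matrix (Fin p) (Fin n) ℂ)
    (D : Matrix (Fin p) (Fin m) ℂ) : ℕ → Submodule ℂ (Fin n → ℂ)
  | 0 => ⊥
  | (j + 1) => Submodule.map ((A.mulVecLin).coprod B.mulVecLin)
      (((sSeq A B C D j).prod ⊤) ⊓ LinearMap.ker ((C.mulVecLin).coprod D.mulVecLin))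

/-- Diagonalizable endomorphism: the eigenspaces span the whole space. -/
def IsDiagonalizable {M : Type*} [AddCommGroup M] [Module ℂ M]
    (f : M →ₗ[ℂ] M) : Prop :=
  (⨆ μ : ℂ, Module.End.eigenspace f μ) = ⊤

section StateFeedback

variable {K V : Type*} [Field K] [AddCommGroup V] [Module K V]

/-- The reachability sequence `0, E, E + T E, E + T E + T² E, …` of a pair `(T, E)`. -/
def reachSeq (T : Module.End K V) (E : Submodule K V) : ℕ → Submodule K V
  | 0 => ⊥
  | j + 1 => E ⊔ (reachSeq T E j).map T

theorem reachSeq_add_of_range_le {T G : Module.End K V} {E : Submodule K V}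
    (hG : LinearMap.range G ≤ E) (j : ℕ) : reachSeq (T + G) E j = reachSeq T E j := by
  have hGE (x : V) : G x ∈ E := hG ⟨x, rfl⟩
  induction j with
  | zero => rfl
  | succ j ih =>
    simp only [reachSeq, ih]
    apply le_antisymm <;> refine sup_le le_sup_left ?_ <;> rintro _ ⟨x, hx, rfl⟩
    · exact add_mem (mem_sup_right (mem_map_of_mem hx)) (mem_sup_left (hGE x))
    · have : T x = (T + G) x - G x := by simp
      rw [this]
      exact sub_mem (mem_sup_right (mem_map_of_mem hx)) (mem_sup_left (hGE x))

theorem comap_add_of_range_le {T G : Module.End K V} {E : Submodule K V}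
    (hG : LinearMap.range G ≤ E) : E.comap (T + G) = E.comap T := by
  ext x
  exact E.add_mem_iff_left (hG ⟨x, rfl⟩)

theorem map_pow_le_reachSeq (T : Module.End K V) (E : Submodule K V) {i j : ℕ} (hij : i < j) :
    E.map (T ^ i) ≤ reachSeq T E j := by
  induction i generalizing j with
  | zero =>
    obtain ⟨j, rfl⟩ := Nat.exists_eq_add_of_lt hij
    simp [reachSeq, Module.End.one_eq_id]
  | succ i ih =>
    obtain ⟨j, rfl⟩ : ∃ k, j = k + 1 := ⟨j - 1, by omega⟩
    rw [pow_succ', Module.End.mul_eq_comp, Submodule.map_comp]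
    exact (Submodule.map_mono (ih (by omega))).trans le_sup_right

theorem reachSeq_le_of_map_pow_le {T : Module.End K V} {E S : Submodule K V} {j : ℕ}
    (hS : ∀ i < j, E.map (T ^ i) ≤ S) : reachSeq T E j ≤ S := by
  induction j generalizing S with
  | zero => exact bot_le
  | succ j ih =>
    refine sup_le (by simpa [Module.End.one_eq_id] using hS 0 (by omega)) ?_
    rw [Submodule.map_le_iff_le_comap]
    refine ih fun i hi ↦ ?_
    rw [← Submodule.map_le_iff_le_comap, ← Submodule.map_comp, ← Module.End.mul_eq_comp,
      ← pow_succ']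
    exact hS _ (by omega)

open Polynomial in
theorem map_aeval_le_reachSeq (T : Module.End K V) (E : Submodule K V) {q : K[X]} {j : ℕ}
    (hq : q.degree < j) : E.map (aeval T q) ≤ reachSeq T E j := by
  rintro _ ⟨x, hx, rfl⟩
  rw [aeval_eq_sum_range, LinearMap.sum_apply]
  refine sum_mem fun i _ ↦ ?_
  by_cases hi : i < j
  · exact Submodule.smul_mem _ _ (map_pow_le_reachSeq T E hi (mem_map_of_mem hx))
  · have : q.coeff i = 0 := coeff_eq_zero_of_degree_lt
      (hq.trans_le (by exact_mod_cast not_lt.mp hi))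
    simp [this]

open Polynomial in
theorem iSup_map_nodal_erase {h : ℕ} (T : Module.End K V) (E : Submodule K V) {lam : Fin h → K}
    (hlam : Function.Injective lam) :
    ⨆ i, E.map (aeval T (Lagrange.nodal (Finset.univ.erase i) lam)) = reachSeq T E h := by
  apply le_antisymm
  · refine iSup_le fun i ↦ map_aeval_le_reachSeq T E ?_
    rw [Lagrange.degree_nodal, Finset.card_erase_of_mem (Finset.mem_univ i), Finset.card_fin]
    have := i.pos
    exact_mod_cast Nat.sub_lt this one_pos
  · refine reachSeq_le_of_map_pow_le fun j hj ↦ ?_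
    rintro _ ⟨x, hx, rfl⟩
    have hX : T ^ j = aeval T ((X : K[X]) ^ j) := by simp
    rw [hX, Lagrange.eq_interpolate (s := Finset.univ) (v := lam) hlam.injOn (f := X ^ j)
      (by simpa using hj), Lagrange.interpolate_eq_sum, map_sum, LinearMap.sum_apply]
    refine sum_mem fun i _ ↦ Submodule.mem_iSup_of_mem i ?_
    rw [← smul_eq_C_mul, map_smul, LinearMap.smul_apply]
    exact Submodule.smul_mem _ _ (mem_map_of_mem hx)

open Polynomial in
theorem finrank_iSup_comap_of_isUnit [FiniteDimensional K V] {h : ℕ} (T : Module.End K V)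
    (E : Submodule K V) {lam : Fin h → K} (hlam : Function.Injective lam)
    (hT : ∀ i, IsUnit (T - algebraMap K _ (lam i))) :
    Module.finrank K ↥(⨆ i, E.comap (T - algebraMap K _ (lam i))) =
      Module.finrank K ↥(reachSeq T E h) := by
  have hfac (i : Fin h) : aeval T (Lagrange.nodal Finset.univ lam) =
      aeval T (Lagrange.nodal (Finset.univ.erase i) lam) * (T - algebraMap K _ (lam i)) := by
    rw [Lagrange.nodal_eq_mul_nodal_erase (Finset.mem_univ i), mul_comm]
    simp
  have hunit (s : Finset (Fin h)) : IsUnit (aeval T (Lagrange.nodal s lam)) := by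
    induction s using Finset.induction_on with
    | empty => simp
    | insert i s hi ih =>
      rw [Lagrange.nodal_insert_eq_nodal hi, map_mul]
      exact IsUnit.mul (by simpa using hT i) ih
  have hinj := LinearMap.ker_eq_bot.mp ((LinearMap.isUnit_iff_ker_eq_bot _).mp (hunit Finset.univ))
  rw [← iSup_map_nodal_erase T E hlam, (Submodule.equivMapOfInjective _ hinj _).finrank_eq,
    Submodule.map_iSup]
  suffices hmap : ∀ i, (E.comap (T - algebraMap K _ (lam i))).map
      (aeval T (Lagrange.nodal Finset.univ lam)) =
      E.map (aeval T (Lagrange.nodal (Finset.univ.erase i) lam)) by rw [iSup_congr hmap]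
  intro i
  rw [hfac i, Module.End.mul_eq_comp, Submodule.map_comp, Submodule.map_comap_eq_of_surjective]
  exact LinearMap.range_eq_top.mp ((LinearMap.isUnit_iff_range_eq_top _).mp (hT i))

open Polynomial in
theorem finite_setOf_det_add_smul_eq_zero [FiniteDimensional K V] (M N : Module.End K V) {t₀ : K}
    (ht₀ : LinearMap.det (M + t₀ • N) ≠ 0) :
    {t : K | LinearMap.det (M + t • N) = 0}.Finite := by
  let b := Module.finBasis K V
  let q : K[X] :=
    ((LinearMap.toMatrix b b M).map C + (X : K[X]) • (LinearMap.toMatrix b b N).map C).det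
  have hq (t : K) : q.eval t = LinearMap.det (M + t • N) := by
    rw [← LinearMap.det_toMatrix b, ← coe_evalRingHom, RingHom.map_det]
    congr 1
    ext i j
    simpa using mul_comm _ _
  have hq0 : q ≠ 0 := fun h0 ↦ ht₀ (by rw [← hq, h0, eval_zero])
  refine (q.rootSet_finite K).subset fun t ht ↦ ?_
  rw [mem_rootSet]
  exact ⟨hq0, by simpa [hq] using ht⟩

theorem exists_det_add_ne_zero [FiniteDimensional K V] (T : Module.End K V) (E : Submodule K V)
    (hE : Module.finrank K ↥(E.comap T) ≤ Module.finrank K E) :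
    ∃ G : Module.End K V, LinearMap.range G ≤ E ∧ LinearMap.det (T + G) ≠ 0 := by
  obtain ⟨e, he⟩ := finrank_le_iff_exists_linearMap.mp hE
  obtain ⟨P, hP⟩ := (E.comap T).subtype.exists_leftInverse_of_injective
    (E.comap T).ker_subtype
  have hP (w : E.comap T) : P w = w := LinearMap.congr_fun hP w
  refine ⟨E.subtype ∘ₗ e ∘ₗ P - T ∘ₗ (E.comap T).subtype ∘ₗ P, ?_, ?_⟩
  · rintro _ ⟨x, rfl⟩
    exact sub_mem (e (P x)).2 (P x).2
  · refine ((LinearMap.isUnit_iff_isUnit_det _).mp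
      ((LinearMap.isUnit_iff_ker_eq_bot _).mpr (LinearMap.ker_eq_bot'.mpr fun x hx ↦ ?_))).ne_zero
    have hx' : T x = T (P x) - e (P x) := by
      simp only [LinearMap.add_apply, LinearMap.sub_apply, LinearMap.comp_apply,
        Submodule.subtype_apply] at hx
      rw [← sub_eq_zero, ← hx]
      abel
    have hxE : x ∈ E.comap T := by
      rw [Submodule.mem_comap, hx']
      exact sub_mem (P x).2 (e (P x)).2
    have hPx : P x = ⟨x, hxE⟩ := hP ⟨x, hxE⟩
    have he0 : e ⟨x, hxE⟩ = 0 := by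
      rw [hPx] at hx'
      exact Subtype.ext (sub_eq_self.mp hx'.symm)
    simpa using he (he0.trans (map_zero e).symm)

theorem exists_forall_det_add_sub_ne_zero [Infinite K] [FiniteDimensional K V] (T : Module.End K V)
    (E : Submodule K V) (s : Finset K)
    (hs : ∀ μ ∈ s, Module.finrank K ↥(E.comap (T - algebraMap K _ μ)) ≤ Module.finrank K E) :
    ∃ G : Module.End K V, LinearMap.range G ≤ E ∧
      ∀ μ ∈ s, LinearMap.det (T + G - algebraMap K _ μ) ≠ 0 := by
  induction s using Finset.cons_induction with
  | empty => exact ⟨0, by simp, by simp⟩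
  | cons a s ha ih =>
    obtain ⟨G, hGE, hG⟩ := ih fun μ hμ ↦ hs μ (Finset.mem_cons_of_mem hμ)
    obtain ⟨G', hGE', hG'⟩ := exists_det_add_ne_zero _ E (hs a (Finset.mem_cons_self a s))
    have hfin : (⋃ μ ∈ Finset.cons a s ha,
        {t : K | LinearMap.det (T + G - algebraMap K _ μ + t • (G' - G)) = 0}).Finite := by
      refine Set.Finite.biUnion (Finset.finite_toSet _) fun μ hμ ↦ ?_
      rcases Finset.mem_cons.mp hμ with rfl | hμ
      · refine finite_setOf_det_add_smul_eq_zero _ _ (t₀ := 1) ?_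
        convert hG' using 2
        module
      · refine finite_setOf_det_add_smul_eq_zero _ _ (t₀ := 0) ?_
        simpa using hG μ hμ
    obtain ⟨t, ht⟩ := hfin.exists_notMem
    refine ⟨G + t • (G' - G), ?_, fun μ hμ h0 ↦ ht ?_⟩
    · rintro _ ⟨x, rfl⟩
      exact add_mem (hGE ⟨x, rfl⟩) (E.smul_mem t (sub_mem (hGE' ⟨x, rfl⟩) (hGE ⟨x, rfl⟩)))
    · refine Set.mem_biUnion hμ ?_
      rw [Set.mem_ofPred_eq, ← h0]
      congr 1
      module

theorem finrank_iSup_comap_eq_finrank_reachSeq [Infinite K] [FiniteDimensional K V] {h : ℕ}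
    (T : Module.End K V) (E : Submodule K V) {lam : Fin h → K} (hlam : Function.Injective lam)
    (hE : ∀ i, Module.finrank K ↥(E.comap (T - algebraMap K _ (lam i))) ≤ Module.finrank K E) :
    Module.finrank K ↥(⨆ i, E.comap (T - algebraMap K _ (lam i))) =
      Module.finrank K ↥(reachSeq T E h) := by
  classical
  obtain ⟨G, hGE, hG⟩ := exists_forall_det_add_sub_ne_zero T E (Finset.univ.image lam)
    (by simpa using hE)
  have hunit (i : Fin h) : IsUnit (T + G - algebraMap K _ (lam i)) :=
    (LinearMap.isUnit_iff_isUnit_det _).mpr (isUnit_iff_ne_zero.mpr (hG _ (by simp)))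
  rw [← reachSeq_add_of_range_le hGE, ← finrank_iSup_comap_of_isUnit (T + G) E hlam hunit]
  have hcomap (i : Fin h) : E.comap (T + G - algebraMap K _ (lam i)) =
      E.comap (T - algebraMap K _ (lam i)) := by
    rw [add_sub_right_comm, comap_add_of_range_le hGE]
  rw [iSup_congr hcomap]

end StateFeedback

section Rosenbrock

variable {n m p : ℕ} {A : Matrix (Fin n) (Fin n) ℂ} {B : Matrix (Fin n) (Fin m) ℂ}
  {C : Matrix (Fin p) (Fin n) ℂ} {D : Matrix (Fin p) (Fin m) ℂ}

theorem mem_rosSub {lam : ℂ} {x : Fin n → ℂ} :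
    x ∈ rosSub A B C D lam ↔
      ∃ u : Fin m → ℂ, A *ᵥ x + B *ᵥ u = lam • x ∧ C *ᵥ x + D *ᵥ u = 0 := by
  simp only [rosSub, Submodule.mem_map, LinearMap.mem_ker, LinearMap.prod_apply, Prod.exists,
    LinearMap.coprod_apply, Matrix.mulVecLin_apply, LinearMap.fst_apply, Function.prod_apply,
    Prod.mk_eq_zero, Matrix.sub_mulVec, Matrix.smul_mulVec, Matrix.one_mulVec]
  constructor
  · rintro ⟨x, u, ⟨h1, h2⟩, rfl⟩
    exact ⟨u, by rw [← sub_eq_zero, ← h1]; abel, h2⟩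
  · rintro ⟨u, h1, h2⟩
    exact ⟨x, u, ⟨by rw [sub_add_eq_add_sub, h1, sub_self], h2⟩, rfl⟩

theorem mem_sSeq_succ {j : ℕ} {y : Fin n → ℂ} :
    y ∈ sSeq A B C D (j + 1) ↔
      ∃ x ∈ sSeq A B C D j, ∃ u : Fin m → ℂ, C *ᵥ x + D *ᵥ u = 0 ∧ A *ᵥ x + B *ᵥ u = y := by
  simp [sSeq, Submodule.mem_map, and_assoc]

variable (A B C D) in
/-- The states from which some input with zero output leads into `V`. -/
def preState (V : Submodule ℂ (Fin n → ℂ)) : Submodule ℂ (Fin n → ℂ) :=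
  Submodule.map (LinearMap.fst ℂ (Fin n → ℂ) (Fin m → ℂ))
    (V.comap ((A.mulVecLin).coprod B.mulVecLin) ⊓
      LinearMap.ker ((C.mulVecLin).coprod D.mulVecLin))

theorem mem_preState {V : Submodule ℂ (Fin n → ℂ)} {x : Fin n → ℂ} :
    x ∈ preState A B C D V ↔
      ∃ u : Fin m → ℂ, A *ᵥ x + B *ᵥ u ∈ V ∧ C *ᵥ x + D *ᵥ u = 0 := by
  simp [preState, Submodule.mem_map]

theorem preState_mono {V V' : Submodule ℂ (Fin n → ℂ)} (hV : V ≤ V') :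
    preState A B C D V ≤ preState A B C D V' := by
  intro x hx
  obtain ⟨u, h1, h2⟩ := mem_preState.mp hx
  exact mem_preState.mpr ⟨u, hV h1, h2⟩

theorem isOutputNulling_iff_le_preState {V : Submodule ℂ (Fin n → ℂ)} :
    IsOutputNulling A B C D V ↔ V ≤ preState A B C D V := by
  constructor
  · rintro ⟨F, hA, hC⟩ x hx
    refine mem_preState.mpr ⟨F *ᵥ x, ?_, ?_⟩
    · simpa [Matrix.add_mulVec] using hA x hx
    · simpa [Matrix.add_mulVec] using hC hx
  · intro hV
    let N := (V.comap ((A.mulVecLin).coprod B.mulVecLin) ⊓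
      LinearMap.ker ((C.mulVecLin).coprod D.mulVecLin)) ⊓
      V.comap (LinearMap.fst ℂ (Fin n → ℂ) (Fin m → ℂ))
    let π : N →ₗ[ℂ] V := (LinearMap.fst ℂ (Fin n → ℂ) (Fin m → ℂ)).restrict fun z hz ↦ hz.2
    have hπ : LinearMap.range π = ⊤ := by
      refine LinearMap.range_eq_top.mpr fun x ↦ ?_
      obtain ⟨u, h1, h2⟩ := mem_preState.mp (hV x.2)
      exact ⟨⟨(x, u), ⟨by simpa using h1, by simpa using h2⟩, x.2⟩, rfl⟩
    obtain ⟨σ, hσ⟩ := π.exists_rightInverse_of_surjective hπ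
    obtain ⟨F, hF⟩ := LinearMap.exists_extend (LinearMap.snd ℂ (Fin n → ℂ) (Fin m → ℂ) ∘ₗ
      N.subtype ∘ₗ σ)
    have hσF (x : V) : (σ x : (Fin n → ℂ) × (Fin m → ℂ)) = (x.1, F x) :=
      Prod.ext (congrArg Subtype.val (LinearMap.congr_fun hσ x)) (LinearMap.congr_fun hF x).symm
    refine ⟨LinearMap.toMatrix' F, fun x hx ↦ ?_, fun x hx ↦ ?_⟩
    · have := (σ ⟨x, hx⟩).2.1.1
      rw [hσF] at this
      simpa [Matrix.add_mulVec, ← Matrix.mulVec_mulVec, LinearMap.toMatrix'_mulVec] using this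
    · have := (σ ⟨x, hx⟩).2.1.2
      rw [hσF] at this
      simpa [Matrix.add_mulVec, ← Matrix.mulVec_mulVec, LinearMap.toMatrix'_mulVec] using this

theorem le_vStar {V : Submodule ℂ (Fin n → ℂ)} (hV : V ≤ preState A B C D V) :
    V ≤ vStar A B C D :=
  le_sSup (isOutputNulling_iff_le_preState.mpr hV)

variable (A B C D) in
theorem vStar_eq_preState : vStar A B C D = preState A B C D (vStar A B C D) := by
  have hle : vStar A B C D ≤ preState A B C D (vStar A B C D) := sSup_le fun V hV ↦
    (isOutputNulling_iff_le_preState.mp hV).trans (preState_mono (le_sSup hV))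
  exact hle.antisymm (le_vStar (preState_mono hle))

theorem mem_vStar_of_step {x : Fin n → ℂ} {u : Fin m → ℂ} (hA : A *ᵥ x + B *ᵥ u ∈ vStar A B C D)
    (hC : C *ᵥ x + D *ᵥ u = 0) : x ∈ vStar A B C D := by
  rw [vStar_eq_preState]
  exact mem_preState.mpr ⟨u, hA, hC⟩

theorem rosSub_le_vStar (lam : ℂ) : rosSub A B C D lam ≤ vStar A B C D := by
  refine le_vStar fun x hx ↦ ?_
  obtain ⟨u, h1, h2⟩ := mem_rosSub.mp hx
  exact mem_preState.mpr ⟨u, h1 ▸ Submodule.smul_mem _ lam hx, h2⟩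

theorem finrank_rosSub_add_rank (lam : ℂ) :
    Module.finrank ℂ (rosSub A B C D lam) + (rosenbrock A B C D lam).rank +
      Module.finrank ℂ ↥(LinearMap.ker B.mulVecLin ⊓ LinearMap.ker D.mulVecLin) = n + m := by
  let L := (((A - lam • 1).mulVecLin).coprod B.mulVecLin).prod ((C.mulVecLin).coprod D.mulVecLin)
  have hrank : (rosenbrock A B C D lam).rank = Module.finrank ℂ (LinearMap.range L) := by
    have hconj : (rosenbrock A B C D lam).mulVecLin =
        (LinearEquiv.sumArrowLequivProdArrow (Fin n) (Fin p) ℂ ℂ).symm.toLinearMap ∘ₗ L ∘ₗ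
          (LinearEquiv.sumArrowLequivProdArrow (Fin n) (Fin m) ℂ ℂ).toLinearMap := by
      refine LinearMap.ext fun z ↦ ?_
      obtain ⟨⟨x, u⟩, rfl⟩ :=
        (LinearEquiv.sumArrowLequivProdArrow (Fin n) (Fin m) ℂ ℂ).symm.surjective z
      ext (i | i) <;> simp [rosenbrock, L, Matrix.fromBlocks_mulVec, Function.comp_def,
        Matrix.sub_mulVec, Matrix.smul_mulVec]
    rw [Matrix.rank, hconj, LinearMap.range_comp, LinearEquiv.finrank_map_eq,
      LinearMap.range_comp_of_range_eq_top _ (LinearEquiv.range _)]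
  have hker : Module.finrank ℂ (rosSub A B C D lam) +
      Module.finrank ℂ ↥(LinearMap.ker B.mulVecLin ⊓ LinearMap.ker D.mulVecLin) =
      Module.finrank ℂ (LinearMap.ker L) := by
    rw [← ((LinearMap.fst ℂ (Fin n → ℂ) (Fin m → ℂ)).domRestrict
      (LinearMap.ker L)).finrank_range_add_finrank_ker, LinearMap.range_domRestrict]
    congr 1
    have hmap : (LinearMap.ker B.mulVecLin ⊓ LinearMap.ker D.mulVecLin).map
        (LinearMap.inr ℂ (Fin n → ℂ) (Fin m → ℂ)) =
        (LinearMap.ker ((LinearMap.fst ℂ (Fin n → ℂ) (Fin m → ℂ)).domRestrict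
          (LinearMap.ker L))).map (LinearMap.ker L).subtype := by
      ext ⟨x, u⟩
      constructor
      · rintro ⟨u, ⟨hB, hD⟩, h⟩
        simp only [LinearMap.inr_apply, Prod.mk.injEq] at h
        obtain ⟨rfl, rfl⟩ := h
        exact ⟨⟨(0, u), by simpa [L] using ⟨hB, hD⟩⟩, rfl, rfl⟩
      · rintro ⟨⟨⟨x, u⟩, hL⟩, hx, h⟩
        obtain rfl : x = 0 := hx
        refine ⟨u, ?_, h⟩
        simpa [L] using hL
    rw [← Submodule.finrank_map_subtype_eq, ← hmap]
    exact (Submodule.equivMapOfInjective _ LinearMap.inr_injective _).finrank_eq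
  have hdim := L.finrank_range_add_finrank_ker
  rw [Module.finrank_prod, Module.finrank_fin_fun, Module.finrank_fin_fun] at hdim
  omega

theorem finrank_rosSub_le_of_not_isInvariantZero {lam : ℂ} (hlam : ¬ IsInvariantZero A B C D lam)
    (μ : ℂ) :
    Module.finrank ℂ (rosSub A B C D lam) ≤ Module.finrank ℂ (rosSub A B C D μ) := by
  have hbdd : BddAbove (Set.range fun μ : ℂ ↦ (rosenbrock A B C D μ).rank) :=
    ⟨_, by rintro _ ⟨μ, rfl⟩; exact Matrix.rank_le_card_width _⟩
  have hrank := (le_ciSup hbdd μ).trans (not_lt.mp hlam)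
  have h1 := finrank_rosSub_add_rank (A := A) (B := B) (C := C) (D := D) lam
  have h2 := finrank_rosSub_add_rank (A := A) (B := B) (C := C) (D := D) μ
  omega

variable (A B C D) in
/-- On `𝒱*` the system becomes a pair `(T, E)`, up to the choice of a friend of `𝒱*`. -/
theorem exists_closedLoop : ∃ (T : Module.End ℂ (vStar A B C D)) (E : Submodule ℂ (vStar A B C D)),
    (∀ lam : ℂ, (E.comap (T - algebraMap ℂ _ lam)).map (vStar A B C D).subtype =
      rosSub A B C D lam) ∧
    ∀ j, (reachSeq T E j).map (vStar A B C D).subtype = vStar A B C D ⊓ sSeq A B C D j := by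
  obtain ⟨F, hA, hC⟩ := isOutputNulling_iff_le_preState.mpr (vStar_eq_preState A B C D).le
  let T : Module.End ℂ (vStar A B C D) := (A + B * F).mulVecLin.restrict hA
  let E : Submodule ℂ (vStar A B C D) :=
    ((LinearMap.ker D.mulVecLin).map B.mulVecLin).comap (vStar A B C D).subtype
  have hT (x : vStar A B C D) : (T x : Fin n → ℂ) = A *ᵥ x + B *ᵥ F *ᵥ x := by
    simp [T]
  have hCx {x : Fin n → ℂ} (hx : x ∈ vStar A B C D) : C *ᵥ x + D *ᵥ F *ᵥ x = 0 := by
    simpa [Matrix.add_mulVec] using hC hx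
  have hE {x : vStar A B C D} : x ∈ E ↔ ∃ u, D *ᵥ u = 0 ∧ B *ᵥ u = x := by
    simp [E, Submodule.mem_map]
  refine ⟨T, E, fun lam ↦ ?_, fun j ↦ ?_⟩
  · ext x
    rw [mem_rosSub]
    constructor
    · rintro ⟨x, hx, rfl⟩
      obtain ⟨u, hD, hB⟩ := hE.mp hx
      refine ⟨F *ᵥ x - u, ?_, ?_⟩
      · rw [Matrix.mulVec_sub, hB]
        simp only [LinearMap.sub_apply, Module.algebraMap_end_apply, Submodule.coe_sub,
          Submodule.coe_smul, Submodule.subtype_apply, hT]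
        abel
      · rw [Matrix.mulVec_sub, hD, Submodule.subtype_apply, sub_zero, hCx x.2]
    · rintro ⟨u, h1, h2⟩
      have hx := rosSub_le_vStar lam (mem_rosSub.mpr ⟨u, h1, h2⟩)
      refine ⟨⟨x, hx⟩, hE.mpr ⟨F *ᵥ x - u, ?_, ?_⟩, rfl⟩
      · rw [Matrix.mulVec_sub, ← sub_eq_zero.mpr ((hCx hx).trans h2.symm)]
        abel
      · simp [hT, ← h1, Matrix.mulVec_sub]
  · induction j with
    | zero => simp [reachSeq, sSeq]
    | succ j ih =>
      ext y
      rw [Submodule.mem_inf, mem_sSeq_succ]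
      constructor
      · rintro ⟨y, hy, rfl⟩
        obtain ⟨e, he, _, ⟨x, hx, rfl⟩, rfl⟩ := Submodule.mem_sup.mp hy
        obtain ⟨u, hD, hB⟩ := hE.mp he
        have hxS : (x : Fin n → ℂ) ∈ vStar A B C D ⊓ sSeq A B C D j :=
          ih ▸ Submodule.mem_map_of_mem hx
        refine ⟨(e + T x).2, x, hxS.2, F *ᵥ x + u, ?_, ?_⟩
        · rw [Matrix.mulVec_add, hD, add_zero, hCx x.2]
        · simp only [Matrix.mulVec_add, hB, Submodule.subtype_apply, Submodule.coe_add, hT]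
          abel
      · rintro ⟨hy, x, hxS, u, h2, rfl⟩
        have hx := mem_vStar_of_step hy h2
        obtain ⟨x, hxR, rfl⟩ := ih.ge ⟨hx, hxS⟩
        refine ⟨⟨_, hy⟩, ?_, rfl⟩
        have hsplit : (⟨_, hy⟩ : vStar A B C D) = (⟨_, hy⟩ - T x) + T x := by abel
        rw [hsplit]
        refine Submodule.add_mem_sup (hE.mpr ⟨u - F *ᵥ x, ?_, ?_⟩) (Submodule.mem_map_of_mem hxR)
        · rw [Matrix.mulVec_sub, ← sub_eq_zero.mpr (h2.trans (hCx hx).symm),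
            Submodule.subtype_apply]
          abel
        · simp [hT, Matrix.mulVec_sub]

end Rosenbrock

theorem dim_sum_rosSub_eq_dim_vStar_inf_sSeq (n m p : ℕ)
    (hn : 0 < n) (hm : 0 < m) (hp : 0 < p)
    (A : Matrix (Fin n) (Fin n) ℂ) (B : Matrix (Fin n) (Fin m) ℂ)
    (C : Matrix (Fin p) (Fin n) ℂ) (D : Matrix (Fin p) (Fin m) ℂ)
    (h : ℕ) (hh : 1 ≤ h) (lam : Fin h → ℂ)
    (hdist : Function.Injective lam)
    (hz : ∀ i, ¬ IsInvariantZero A B C D (lam i)) :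
    Module.finrank ℂ ↥(⨆ i, rosSub A B C D (lam i)) =
      Module.finrank ℂ ↥(vStar A B C D ⊓ sSeq A B C D h) := by
  obtain ⟨T, E, hW, hS⟩ := exists_closedLoop A B C D
  have hE (i : Fin h) : Module.finrank ℂ ↥(E.comap (T - algebraMap ℂ _ (lam i))) ≤
      Module.finrank ℂ E := by
    obtain ⟨μ, hμ⟩ := (Module.End.finite_spectrum T).exists_notMem
    rw [spectrum.notMem_iff, IsUnit.sub_iff, LinearMap.isUnit_iff_ker_eq_bot,
      LinearMap.ker_eq_bot] at hμ
    rw [← Submodule.finrank_map_subtype_eq, hW]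
    refine (finrank_rosSub_le_of_not_isInvariantZero (hz i) μ).trans ?_
    rw [← hW μ, Submodule.finrank_map_subtype_eq,
      (Submodule.equivMapOfInjective _ hμ _).finrank_eq]
    exact Submodule.finrank_mono (Submodule.map_comap_le _ _)
  rw [← iSup_congr fun i ↦ hW (lam i), ← Submodule.map_iSup, ← hS,
    Submodule.finrank_map_subtype_eq, Submodule.finrank_map_subtype_eq]
  exact finrank_iSup_comap_eq_finrank_reachSeq T E hdist hE
end

section
/- Let h ≥ 1 and let λ_1, …, λ_h be distinct complex numbers, none of which is an invariant zero of (A,B,C,D). Set 𝒦_h := W(λ_1) + ⋯ + W(λ_h), which is an output-nulling subspace. Then for every friend F of 𝒦_h, the smallest (A+BF)-invariant subspace containing 𝒦_h ∩ B(ker D) equals the largest output-nulling subspace contained in 𝒮_h. -/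
open Matrix Submodule

section Helpers

variable {n m p : ℕ} {A : Matrix (Fin n) (Fin n) ℂ} {B : Matrix (Fin n) (Fin m) ℂ}
  {C : Matrix (Fin p) (Fin n) ℂ} {D : Matrix (Fin p) (Fin m) ℂ}

theorem mem_rosSub_iff {lam : ℂ} {x : Fin n → ℂ} :
    x ∈ rosSub A B C D lam ↔ ∃ u, A *ᵥ x + B *ᵥ u = lam • x ∧ C *ᵥ x + D *ᵥ u = 0 := by
  have hiff : ∀ u : Fin m → ℂ,
      A *ᵥ x - lam • x + B *ᵥ u = 0 ↔ A *ᵥ x + B *ᵥ u = lam • x := fun u => by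
    rw [← sub_eq_zero (b := lam • x), sub_add_eq_add_sub]
  simp [rosSub, hiff]

theorem mem_sSeq_succ_iff {j : ℕ} {y : Fin n → ℂ} :
    y ∈ sSeq A B C D (j + 1) ↔
      ∃ x ∈ sSeq A B C D j, ∃ u, C *ᵥ x + D *ᵥ u = 0 ∧ A *ᵥ x + B *ᵥ u = y := by
  simp [sSeq, and_assoc]

theorem sSeq_monotone : Monotone (sSeq A B C D) := by
  refine monotone_nat_of_le_succ fun j => ?_
  induction j with
  | zero => exact bot_le
  | succ j ih =>
    intro y hy
    obtain ⟨x, hx, u, h0, hu⟩ := mem_sSeq_succ_iff.1 hy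
    exact mem_sSeq_succ_iff.2 ⟨x, ih hx, u, h0, hu⟩

theorem add_mul_mulVecLin_apply {q : ℕ} {M : Matrix (Fin q) (Fin n) ℂ}
    {N : Matrix (Fin q) (Fin m) ℂ} (F : Matrix (Fin m) (Fin n) ℂ) (x : Fin n → ℂ) :
    (M + N * F).mulVecLin x = M *ᵥ x + N *ᵥ (F *ᵥ x) := by
  simp

/-- Values prescribed on a set are attained by a linear map on a subset with the same span. -/
theorem exists_matrix_eqOn_subset_span_eq (s : Set (Fin n → ℂ)) (u : (Fin n → ℂ) → Fin m → ℂ) :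
    ∃ (b : Set (Fin n → ℂ)) (F : Matrix (Fin m) (Fin n) ℂ),
      b ⊆ s ∧ span ℂ b = span ℂ s ∧ ∀ x ∈ b, F *ᵥ x = u x := by
  obtain ⟨b, hbs, hspan, hli⟩ := exists_linearIndependent ℂ s
  replace hli : LinearIndepOn ℂ id b := hli
  refine ⟨b, LinearMap.toMatrix' ((Module.Basis.extend hli).constr ℂ fun x => u x), hbs, hspan,
    fun x hx => ?_⟩
  rw [LinearMap.toMatrix'_mulVec]
  have := (Module.Basis.extend hli).constr_basis ℂ (fun x => u x)
    ⟨x, Module.Basis.subset_extend hli hx⟩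
  rwa [Module.Basis.extend_apply_self] at this

theorem isOutputNulling_iff {V : Submodule ℂ (Fin n → ℂ)} :
    IsOutputNulling A B C D V ↔
      ∀ x ∈ V, ∃ u, A *ᵥ x + B *ᵥ u ∈ V ∧ C *ᵥ x + D *ᵥ u = 0 := by
  constructor
  · rintro ⟨F, hinv, hker⟩ x hx
    refine ⟨F *ᵥ x, ?_, ?_⟩
    · simpa only [add_mul_mulVecLin_apply] using hinv x hx
    · simpa only [LinearMap.mem_ker, add_mul_mulVecLin_apply] using hker hx
  · intro hV
    choose! u hu using hV
    obtain ⟨b, F, hb, hspan, hF⟩ := exists_matrix_eqOn_subset_span_eq (V : Set (Fin n → ℂ)) u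
    rw [span_eq] at hspan
    refine ⟨F, ?_, ?_⟩
    · change V ≤ V.comap (A + B * F).mulVecLin
      conv_lhs => rw [← hspan]
      refine span_le.2 fun x hx => ?_
      simpa only [SetLike.mem_coe, mem_comap, add_mul_mulVecLin_apply, hF x hx]
        using (hu x (hb hx)).1
    · conv_lhs => rw [← hspan]
      refine span_le.2 fun x hx => ?_
      simpa only [SetLike.mem_coe, LinearMap.mem_ker, add_mul_mulVecLin_apply, hF x hx]
        using (hu x (hb hx)).2

theorem isOutputNulling_sSup {s : Set (Submodule ℂ (Fin n → ℂ))}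
    (hs : ∀ V ∈ s, IsOutputNulling A B C D V) : IsOutputNulling A B C D (sSup s) := by
  rw [isOutputNulling_iff]
  intro x hx
  rw [sSup_eq_iSup'] at hx
  induction hx using Submodule.iSup_induction' with
  | mem V x hx =>
    obtain ⟨u, h1, h2⟩ := isOutputNulling_iff.1 (hs V V.2) x hx
    exact ⟨u, le_sSup V.2 h1, h2⟩
  | zero => exact ⟨0, by simp, by simp⟩
  | add x y _ _ hx hy =>
    obtain ⟨u, h1, h2⟩ := hx
    obtain ⟨v, h3, h4⟩ := hy
    refine ⟨u + v, ?_, ?_⟩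
    · rw [Matrix.mulVec_add, Matrix.mulVec_add, add_add_add_comm]
      exact add_mem h1 h3
    · rw [Matrix.mulVec_add, Matrix.mulVec_add, add_add_add_comm, h2, h4, add_zero]

theorem isOutputNulling_rosSub (lam : ℂ) : IsOutputNulling A B C D (rosSub A B C D lam) := by
  rw [isOutputNulling_iff]
  intro x hx
  obtain ⟨u, h1, h2⟩ := mem_rosSub_iff.1 hx
  exact ⟨u, h1 ▸ smul_mem _ _ hx, h2⟩

theorem IsOutputNulling.sup_span_singleton {V : Submodule ℂ (Fin n → ℂ)}
    (hV : IsOutputNulling A B C D V) {x : Fin n → ℂ} {u : Fin m → ℂ}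
    (hx : A *ᵥ x + B *ᵥ u ∈ V) (hxu : C *ᵥ x + D *ᵥ u = 0) :
    IsOutputNulling A B C D (V ⊔ span ℂ {x}) := by
  rw [isOutputNulling_iff] at hV ⊢
  intro y hy
  obtain ⟨v, hv, z, hz, rfl⟩ := mem_sup.1 hy
  obtain ⟨c, rfl⟩ := mem_span_singleton.1 hz
  obtain ⟨w, h1, h2⟩ := hV v hv
  refine ⟨w + c • u, mem_sup_left ?_, ?_⟩
  · rw [Matrix.mulVec_add, Matrix.mulVec_add, add_add_add_comm, Matrix.mulVec_smul,
      Matrix.mulVec_smul, ← smul_add]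
    exact add_mem h1 (smul_mem _ _ hx)
  · rw [Matrix.mulVec_add, Matrix.mulVec_add, add_add_add_comm, Matrix.mulVec_smul,
      Matrix.mulVec_smul, ← smul_add, h2, hxu, smul_zero, add_zero]

/-- The largest output-nulling subspace contained in a given member of the input-containing
sequence. -/
noncomputable def maxOutputNulling (A : Matrix (Fin n) (Fin n) ℂ) (B : Matrix (Fin n) (Fin m) ℂ)
    (C : Matrix (Fin p) (Fin n) ℂ) (D : Matrix (Fin p) (Fin m) ℂ) (h : ℕ) :
    Submodule ℂ (Fin n → ℂ) :=
  sSup {W : Submodule ℂ (Fin n → ℂ) | IsOutputNulling A B C D W ∧ W ≤ sSeq A B C D h}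

theorem isOutputNulling_maxOutputNulling (h : ℕ) :
    IsOutputNulling A B C D (maxOutputNulling A B C D h) :=
  isOutputNulling_sSup fun _ hV => hV.1

theorem maxOutputNulling_le_sSeq (h : ℕ) : maxOutputNulling A B C D h ≤ sSeq A B C D h :=
  sSup_le fun _ hV => hV.2

/-- The predecessor in the input-containing sequence of a vector of the maximal output-nulling
subspace lies again in that subspace. -/
theorem exists_pred_mem_maxOutputNulling {h j : ℕ} (hj : j < h) {x : Fin n → ℂ}
    (hx : x ∈ maxOutputNulling A B C D h) (hxS : x ∈ sSeq A B C D (j + 1)) :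
    ∃ y ∈ maxOutputNulling A B C D h, y ∈ sSeq A B C D j ∧
      ∃ u, C *ᵥ y + D *ᵥ u = 0 ∧ A *ᵥ y + B *ᵥ u = x := by
  obtain ⟨y, hy, u, h0, rfl⟩ := mem_sSeq_succ_iff.1 hxS
  refine ⟨y, ?_, hy, u, h0, rfl⟩
  have hle : maxOutputNulling A B C D h ⊔ span ℂ {y} ≤ maxOutputNulling A B C D h :=
    le_sSup ⟨(isOutputNulling_maxOutputNulling h).sup_span_singleton hx h0,
      sup_le (maxOutputNulling_le_sSeq h)
        ((span_singleton_le_iff_mem _ _).2 (sSeq_monotone hj.le hy))⟩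
  exact hle (mem_sup_right (mem_span_singleton_self y))

/-- If every vector is reached from `E` in `h` steps of `T`, then the preimages of `E` under
`T - λᵢ`, for `h` distinct scalars `λᵢ`, span the whole space. -/
theorem iSup_comap_sub_smul_eq_top {𝕜 X : Type*} [Field 𝕜] [AddCommGroup X] [Module 𝕜 X]
    (T : X →ₗ[𝕜] X) (E : Submodule 𝕜 X) (P : ℕ → Submodule 𝕜 X) {h : ℕ} (hh : 1 ≤ h)
    (hP0 : P 0 = ⊥) (hP : ∀ j < h, P (j + 1) ≤ (P j).map T ⊔ E) (hPh : P h = ⊤)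
    {lam : Fin h → 𝕜} (hlam : Function.Injective lam) :
    ⨆ i, E.comap (T - lam i • LinearMap.id) = ⊤ := by
  by_contra hne
  obtain ⟨φ, hφ0, hφ⟩ := Submodule.exists_le_ker_of_lt_top _ (lt_top_iff_ne_top.2 hne)
  have hfac : ∀ i, ∃ ψ : Module.Dual 𝕜 X,
      (∀ x, ψ (T x) = lam i * ψ x + φ x) ∧ ∀ e ∈ E, ψ e = 0 := by
    intro i
    have hmem : φ ∈ (LinearMap.ker
        (E.mkQ ∘ₗ (T - lam i • LinearMap.id))).dualAnnihilator := by
      rw [Submodule.mem_dualAnnihilator]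
      intro x hx
      refine hφ (mem_iSup_of_mem i ?_)
      simpa [LinearMap.mem_ker, LinearMap.ker_comp] using hx
    rw [← LinearMap.range_dualMap_eq_dualAnnihilator_ker] at hmem
    obtain ⟨χ, hχ⟩ := hmem
    refine ⟨χ ∘ₗ E.mkQ, fun x => ?_, fun e he => ?_⟩
    · rw [← hχ]
      simp
    · simp [(Submodule.Quotient.mk_eq_zero E).2 he]
  choose ψ hψ hψE using hfac
  -- a nonzero vector of weights annihilating the powers `λ ^ k` for `k + 1 < h`
  obtain ⟨c, hc, hc0⟩ : ∃ c : Fin h → 𝕜,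
      (∀ k, k + 1 < h → ∑ i, c i * lam i ^ k = 0) ∧ c ≠ 0 := by
    let L : (Fin h → 𝕜) →ₗ[𝕜] (Fin (h - 1) → 𝕜) :=
      (Matrix.of fun (k : Fin (h - 1)) (i : Fin h) => lam i ^ (k : ℕ)).mulVecLin
    have hL : LinearMap.ker L ≠ ⊥ := LinearMap.ker_ne_bot_of_finrank_lt (by simp; omega)
    obtain ⟨c, hcL, hc0⟩ := Submodule.exists_mem_ne_zero_of_ne_bot hL
    refine ⟨c, fun k hk => ?_, hc0⟩
    have := congrFun (LinearMap.mem_ker.1 hcL) ⟨k, by omega⟩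
    simpa [L, Matrix.mulVec, dotProduct, mul_comm] using this
  have hpow : ∀ k < h, ∀ x, ∑ i, c i * ψ i ((T ^ k) x) = ∑ i, c i * lam i ^ k * ψ i x := by
    intro k
    induction k with
    | zero => simp
    | succ k ih =>
      intro hk x
      rw [pow_succ]
      simp only [Module.End.mul_apply]
      rw [ih (by omega)]
      simp only [hψ, mul_add, Finset.sum_add_distrib]
      rw [← Finset.sum_mul, hc k hk, zero_mul, add_zero]
      simp only [pow_succ, mul_assoc]
  have hvan : ∀ j k, k + j ≤ h → ∀ x ∈ P j, ∑ i, c i * ψ i ((T ^ k) x) = 0 := by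
    intro j
    induction j with
    | zero =>
      intro k _ x hx
      rw [hP0, mem_bot] at hx
      simp [hx]
    | succ j ih =>
      intro k hk x hx
      obtain ⟨_, ⟨y, hy, rfl⟩, e, he, rfl⟩ := mem_sup.1 (hP j (by omega) hx)
      have h1 := ih (k + 1) (by omega) y hy
      rw [pow_succ] at h1
      simp only [Module.End.mul_apply] at h1
      simp only [map_add, mul_add, Finset.sum_add_distrib]
      rw [h1, hpow k (by omega)]
      simp [hψE _ e he]
  have hψ0 : ∀ x, (fun i => c i * ψ i x) = 0 := by
    intro x
    refine Matrix.eq_zero_of_forall_pow_sum_mul_pow_eq_zero hlam fun k => ?_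
    have h1 := hvan h 0 (by omega) ((T ^ (k : ℕ)) x) (hPh ▸ mem_top)
    rw [pow_zero, Module.End.one_apply, hpow k k.2] at h1
    rw [← h1]
    exact Finset.sum_congr rfl fun i _ => by ring
  obtain ⟨i, hi⟩ := Function.ne_iff.1 hc0
  have hψi : ∀ x, ψ i x = 0 := fun x =>
    (mul_eq_zero.1 (congrFun (hψ0 x) i)).resolve_left hi
  refine hφ0 (LinearMap.ext fun x => ?_)
  have := hψ i x
  simpa [hψi] using this.symm

theorem maxOutputNulling_le_iSup_rosSub {h : ℕ} (hh : 1 ≤ h) {lam : Fin h → ℂ}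
    (hlam : Function.Injective lam) :
    maxOutputNulling A B C D h ≤ ⨆ i, rosSub A B C D (lam i) := by
  obtain ⟨G, hinv, hker⟩ := isOutputNulling_maxOutputNulling (A := A) (B := B) (C := C) (D := D) h
  set V := maxOutputNulling A B C D h with hV
  have hker' : ∀ x ∈ V, C *ᵥ x + D *ᵥ (G *ᵥ x) = 0 := fun x hx => by
    simpa only [LinearMap.mem_ker, add_mul_mulVecLin_apply] using hker hx
  set T : V →ₗ[ℂ] V := (A + B * G).mulVecLin.restrict hinv with hT
  have hTx : ∀ x : V, (T x : Fin n → ℂ) = A *ᵥ x + B *ᵥ (G *ᵥ x) := fun x =>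
    add_mul_mulVecLin_apply G x
  set E : Submodule ℂ V :=
    (Submodule.map B.mulVecLin (LinearMap.ker D.mulVecLin)).comap V.subtype with hE
  have htop := iSup_comap_sub_smul_eq_top T E (fun j => (sSeq A B C D j).comap V.subtype) hh
    (by simp [sSeq]) ?_ ?_ hlam
  · have hle : (⨆ i, E.comap (T - lam i • LinearMap.id)) ≤
        (⨆ i, rosSub A B C D (lam i)).comap V.subtype := by
      refine iSup_le fun i x hx => ?_
      refine mem_iSup_of_mem i (mem_rosSub_iff.2 ?_)
      obtain ⟨u, hu, hux⟩ := hx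
      have hux' : B *ᵥ u = A *ᵥ x + B *ᵥ (G *ᵥ x) - lam i • (x : Fin n → ℂ) := by
        rw [← hTx]; exact hux
      have hDu : D *ᵥ u = 0 := hu
      refine ⟨G *ᵥ x - u, ?_, ?_⟩ <;> rw [V.subtype_apply]
      · rw [Matrix.mulVec_sub, hux']
        abel
      · rw [Matrix.mulVec_sub, hDu, sub_zero]
        exact hker' x x.2
    intro x hx
    exact hle (htop ▸ mem_top : (⟨x, hx⟩ : V) ∈ _)
  · rintro j hj ⟨x, hx⟩ hxS
    obtain ⟨y, hy, hyS, u, h0, rfl⟩ := exists_pred_mem_maxOutputNulling hj hx hxS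
    have hsub : B *ᵥ (u - G *ᵥ y) = A *ᵥ y + B *ᵥ u - T ⟨y, hy⟩ := by
      rw [hTx, Matrix.mulVec_sub]
      simp
    refine mem_sup.2 ⟨T ⟨y, hy⟩, mem_map_of_mem hyS, ⟨_, hx⟩ - T ⟨y, hy⟩,
      ⟨u - G *ᵥ y, ?_, hsub⟩, by simp⟩
    change D *ᵥ (u - G *ᵥ y) = 0
    rw [Matrix.mulVec_sub, sub_eq_zero, ← add_right_inj, h0, hker' y hy]
  · rw [eq_top_iff]
    exact fun x _ => maxOutputNulling_le_sSeq h x.2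

/-- A subspace invariant under a friend of an output-nulling `K` and containing
`K ∩ B (ker D)` contains every output-nulling subspace of `𝒮_h` lying in `K`. -/
theorem maxOutputNulling_le_of_invariant {h : ℕ} {K W : Submodule ℂ (Fin n → ℂ)}
    {F : Matrix (Fin m) (Fin n) ℂ} (hVK : maxOutputNulling A B C D h ≤ K)
    (hinv : ∀ x ∈ K, (A + B * F).mulVecLin x ∈ K) (hker : K ≤ LinearMap.ker (C + D * F).mulVecLin)
    (hE : K ⊓ Submodule.map B.mulVecLin (LinearMap.ker D.mulVecLin) ≤ W)
    (hW : Submodule.map (A + B * F).mulVecLin W ≤ W) : maxOutputNulling A B C D h ≤ W := by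
  have hind : ∀ j ≤ h, ∀ x ∈ maxOutputNulling A B C D h, x ∈ sSeq A B C D j → x ∈ W := by
    intro j
    induction j with
    | zero =>
      intro _ x _ hx
      rw [sSeq, mem_bot] at hx
      exact hx ▸ zero_mem _
    | succ j ih =>
      intro hj x hx hxS
      obtain ⟨y, hy, hyS, u, h0, rfl⟩ := exists_pred_mem_maxOutputNulling hj hx hxS
      have hyW := hW (mem_map_of_mem (ih (by omega) y hy hyS))
      have hsub : B *ᵥ (u - F *ᵥ y) = A *ᵥ y + B *ᵥ u - (A + B * F).mulVecLin y := by
        rw [add_mul_mulVecLin_apply, Matrix.mulVec_sub]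
        simp
      have hyK : C *ᵥ y + D *ᵥ (F *ᵥ y) = 0 := by
        simpa only [LinearMap.mem_ker, add_mul_mulVecLin_apply] using hker (hVK hy)
      refine (sub_mem_iff_left W hyW).1 (hE ⟨sub_mem (hVK hx) (hinv y (hVK hy)),
        u - F *ᵥ y, ?_, hsub⟩)
      change D *ᵥ (u - F *ᵥ y) = 0
      rw [Matrix.mulVec_sub, sub_eq_zero, ← add_right_inj, h0, hyK]
  exact fun x hx => hind h le_rfl x hx (maxOutputNulling_le_sSeq h hx)

/-- The sum of the `W(λᵢ)` has a friend whose closed loop is annihilated on it by `∏ (X - λᵢ)`. -/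
theorem exists_friend_aeval_prod_eq_zero {h : ℕ} (lam : Fin h → ℂ) :
    ∃ F : Matrix (Fin m) (Fin n) ℂ,
      (∀ x ∈ ⨆ i, rosSub A B C D (lam i),
        (A + B * F).mulVecLin x ∈ ⨆ i, rosSub A B C D (lam i)) ∧
      (⨆ i, rosSub A B C D (lam i)) ≤ LinearMap.ker (C + D * F).mulVecLin ∧
      ∀ x ∈ ⨆ i, rosSub A B C D (lam i), Polynomial.aeval (A + B * F).mulVecLin
        (∏ i, (Polynomial.X - Polynomial.C (lam i))) x = 0 := by
  set K := ⨆ i, rosSub A B C D (lam i) with hK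
  have hex : ∀ x ∈ ⋃ i, (rosSub A B C D (lam i) : Set (Fin n → ℂ)),
      ∃ u, (∃ i, A *ᵥ x + B *ᵥ u = lam i • x) ∧ C *ᵥ x + D *ᵥ u = 0 := by
    intro x hx
    obtain ⟨i, hi⟩ := Set.mem_iUnion.1 hx
    obtain ⟨u, h1, h2⟩ := mem_rosSub_iff.1 hi
    exact ⟨u, ⟨i, h1⟩, h2⟩
  choose! u hu using hex
  obtain ⟨b, F, hb, hspan, hF⟩ := exists_matrix_eqOn_subset_span_eq
    (⋃ i, (rosSub A B C D (lam i) : Set (Fin n → ℂ))) u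
  rw [← Submodule.iSup_eq_span, ← hK] at hspan
  have heig : ∀ x ∈ b, ∃ i, (A + B * F).mulVecLin x = lam i • x := fun x hx => by
    simpa only [add_mul_mulVecLin_apply, hF x hx] using (hu x (hb hx)).1
  have hbK : ∀ x ∈ b, x ∈ K := fun x hx => hspan ▸ subset_span hx
  refine ⟨F, ?_, ?_, ?_⟩
  · change K ≤ K.comap (A + B * F).mulVecLin
    conv_lhs => rw [← hspan]
    refine span_le.2 fun x hx => ?_
    obtain ⟨i, hi⟩ := heig x hx
    rw [SetLike.mem_coe, mem_comap, hi]
    exact smul_mem _ _ (hbK x hx)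
  · rw [← hspan]
    refine span_le.2 fun x hx => ?_
    simpa only [SetLike.mem_coe, LinearMap.mem_ker, add_mul_mulVecLin_apply, hF x hx]
      using (hu x (hb hx)).2
  · change K ≤ LinearMap.ker (Polynomial.aeval (A + B * F).mulVecLin
        (∏ i, (Polynomial.X - Polynomial.C (lam i))))
    rw [← hspan]
    refine span_le.2 fun x hx => ?_
    obtain ⟨i, hi⟩ := heig x hx
    rw [SetLike.mem_coe, LinearMap.mem_ker, ← Finset.prod_erase_mul _ _ (Finset.mem_univ i),
      map_mul, Module.End.mul_apply]
    rw [map_sub, Polynomial.aeval_X, Polynomial.aeval_C, LinearMap.sub_apply, hi,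
      Module.algebraMap_end_apply, sub_self, map_zero]

/-- Any two friends of `K` differ, on `K`, by an input in `K ∩ B (ker D)`. -/
theorem sub_mem_inf_map_ker {K : Submodule ℂ (Fin n → ℂ)} {F G : Matrix (Fin m) (Fin n) ℂ}
    (hF : ∀ x ∈ K, (A + B * F).mulVecLin x ∈ K) (hFker : K ≤ LinearMap.ker (C + D * F).mulVecLin)
    (hG : ∀ x ∈ K, (A + B * G).mulVecLin x ∈ K) (hGker : K ≤ LinearMap.ker (C + D * G).mulVecLin)
    {x : Fin n → ℂ} (hx : x ∈ K) :
    (A + B * F).mulVecLin x - (A + B * G).mulVecLin x ∈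
      K ⊓ Submodule.map B.mulVecLin (LinearMap.ker D.mulVecLin) := by
  refine ⟨sub_mem (hF x hx) (hG x hx), F *ᵥ x - G *ᵥ x, ?_, ?_⟩
  · have h1 := hFker hx
    have h2 := hGker hx
    rw [LinearMap.mem_ker, add_mul_mulVecLin_apply] at h1 h2
    change D *ᵥ (F *ᵥ x - G *ᵥ x) = 0
    rw [Matrix.mulVec_sub, sub_eq_zero, ← add_right_inj, h1, h2]
  · rw [add_mul_mulVecLin_apply, add_mul_mulVecLin_apply, Matrix.mulVecLin_apply,
      Matrix.mulVec_sub]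
    simp

theorem pow_apply_mem_sSeq {K : Submodule ℂ (Fin n → ℂ)} {F : Matrix (Fin m) (Fin n) ℂ}
    (hF : ∀ x ∈ K, (A + B * F).mulVecLin x ∈ K) (hFker : K ≤ LinearMap.ker (C + D * F).mulVecLin)
    {e : Fin n → ℂ} (he : e ∈ K ⊓ Submodule.map B.mulVecLin (LinearMap.ker D.mulVecLin)) (k : ℕ) :
    ((A + B * F).mulVecLin ^ k) e ∈ K ⊓ sSeq A B C D (k + 1) := by
  induction k with
  | zero =>
    obtain ⟨heK, u, hu, rfl⟩ := he
    refine ⟨heK, mem_sSeq_succ_iff.2 ⟨0, zero_mem _, u, ?_, ?_⟩⟩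
    · have hDu : D *ᵥ u = 0 := hu
      simp [hDu]
    · simp
  | succ k ih =>
    rw [pow_succ', Module.End.mul_apply]
    refine ⟨hF _ ih.1, mem_sSeq_succ_iff.2 ⟨_, ih.2, F *ᵥ _, ?_,
      (add_mul_mulVecLin_apply F _).symm⟩⟩
    simpa only [LinearMap.mem_ker, add_mul_mulVecLin_apply] using hFker ih.1

/-- If the closed loop of a friend is annihilated on `K` by a monic polynomial of degree `h`, its
reachable subspace is contained in `𝒮_h`. -/
theorem pow_apply_mem_sSeq_of_aeval_eq_zero {K : Submodule ℂ (Fin n → ℂ)}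
    {F : Matrix (Fin m) (Fin n) ℂ} (hF : ∀ x ∈ K, (A + B * F).mulVecLin x ∈ K)
    (hFker : K ≤ LinearMap.ker (C + D * F).mulVecLin) {q : Polynomial ℂ} (hq : q.Monic)
    (hqK : ∀ x ∈ K, Polynomial.aeval (A + B * F).mulVecLin q x = 0) {e : Fin n → ℂ}
    (he : e ∈ K ⊓ Submodule.map B.mulVecLin (LinearMap.ker D.mulVecLin)) (k : ℕ) :
    ((A + B * F).mulVecLin ^ k) e ∈ sSeq A B C D q.natDegree := by
  set T := (A + B * F).mulVecLin with hT
  set r := (Polynomial.X ^ k : Polynomial ℂ) %ₘ q with hr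
  have hTe : (T ^ k) e = Polynomial.aeval T r e := by
    have h1 := congrArg (fun s => Polynomial.aeval T s e)
      (Polynomial.modByMonic_add_div (Polynomial.X ^ k : Polynomial ℂ) q)
    simp only [map_add, mul_comm q, map_mul, LinearMap.add_apply, Module.End.mul_apply,
      hqK e he.1, map_zero, add_zero, map_pow, Polynomial.aeval_X] at h1
    exact h1.symm
  rw [hTe, Polynomial.aeval_eq_sum_range, LinearMap.sum_apply]
  refine sum_mem fun i hi => ?_
  rw [LinearMap.smul_apply]
  by_cases hri : r.coeff i = 0
  · simp [hri]
  · refine smul_mem _ _ (sSeq_monotone ?_ (pow_apply_mem_sSeq hF hFker he i).2)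
    have h1 : (i : WithBot ℕ) < q.degree :=
      (Polynomial.le_degree_of_ne_zero hri).trans_lt (Polynomial.degree_modByMonic_lt _ hq)
    rw [Polynomial.degree_eq_natDegree hq.ne_zero] at h1
    exact_mod_cast h1

end Helpers

theorem reachability_on_sum_rosSub (n m p : ℕ)
    (hn : 0 < n) (hm : 0 < m) (hp : 0 < p)
    (A : Matrix (Fin n) (Fin n) ℂ) (B : Matrix (Fin n) (Fin m) ℂ)
    (C : Matrix (Fin p) (Fin n) ℂ) (D : Matrix (Fin p) (Fin m) ℂ)
    (h : ℕ) (hh : 1 ≤ h) (lam : Fin h → ℂ)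
    (hdist : Function.Injective lam)
    (hz : ∀ i, ¬ IsInvariantZero A B C D (lam i))
    (K : Submodule ℂ (Fin n → ℂ))
    (hK : K = ⨆ i, rosSub A B C D (lam i)) :
    IsOutputNulling A B C D K ∧
    ∀ F : Matrix (Fin m) (Fin n) ℂ,
      (∀ x ∈ K, (A + B * F).mulVecLin x ∈ K) →
      K ≤ LinearMap.ker (C + D * F).mulVecLin →
      sInf {W : Submodule ℂ (Fin n → ℂ) |
          K ⊓ Submodule.map B.mulVecLin (LinearMap.ker D.mulVecLin) ≤ W ∧
          Submodule.map (A + B * F).mulVecLin W ≤ W} =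
        sSup {W : Submodule ℂ (Fin n → ℂ) |
          IsOutputNulling A B C D W ∧ W ≤ sSeq A B C D h} := by
  subst hK
  refine ⟨isOutputNulling_sSup ?_, fun F hF hFker => le_antisymm ?_ ?_⟩
  · rintro _ ⟨i, rfl⟩
    exact isOutputNulling_rosSub (lam i)
  · obtain ⟨G, hG, hGker, hGann⟩ :=
      exists_friend_aeval_prod_eq_zero (A := A) (B := B) (C := C) (D := D) lam
    set K := ⨆ i, rosSub A B C D (lam i) with hK
    set E := K ⊓ Submodule.map B.mulVecLin (LinearMap.ker D.mulVecLin) with hE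
    set T := (A + B * G).mulVecLin with hT
    set R : Submodule ℂ (Fin n → ℂ) := ⨆ k : ℕ, E.map (T ^ k) with hR
    have hER : E ≤ R := le_iSup_of_le 0 (by simp [Module.End.one_eq_id])
    have hRK : R ≤ K := by
      refine iSup_le fun k => ?_
      rintro _ ⟨e, he, rfl⟩
      exact (pow_apply_mem_sSeq hG hGker he k).1
    have hTR : R ≤ R.comap T := by
      refine iSup_le fun k => ?_
      rintro _ ⟨e, he, rfl⟩
      refine mem_iSup_of_mem (k + 1) ⟨e, he, ?_⟩
      rw [pow_succ', Module.End.mul_apply]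
    have hFR : ∀ x ∈ R, (A + B * F).mulVecLin x ∈ R := fun x hx =>
      (sub_mem_iff_left R (hTR hx)).1
        (hER (sub_mem_inf_map_ker hF hFker hG hGker (hRK hx)))
    have hRS : R ≤ sSeq A B C D h := by
      refine iSup_le fun k => ?_
      rintro _ ⟨e, he, rfl⟩
      have hmem := pow_apply_mem_sSeq_of_aeval_eq_zero hG hGker
        (Polynomial.monic_prod_X_sub_C lam Finset.univ) hGann he k
      rwa [Polynomial.natDegree_finsetProd_X_sub_C_eq_card, Finset.card_univ,
        Fintype.card_fin] at hmem
    refine (sInf_le ?_ : _ ≤ R).trans (le_sSup ⟨⟨F, hFR, hRK.trans hFker⟩, hRS⟩)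
    exact ⟨hER, map_le_iff_le_comap.2 hFR⟩
  · exact le_sInf fun W hW => maxOutputNulling_le_of_invariant
      (maxOutputNulling_le_iSup_rosSub hh hdist) hF hFker hW.1 hW.2
end

section
/- Let h ≥ 1 and let λ_1, …, λ_h be distinct complex numbers, none of which is an uncontrollable eigenvalue of (A,B). The subspace 𝒱_h := V(λ_1) + ⋯ + V(λ_h) is (A,B)-controlled invariant, and for every F ∈ ℂ^{m×n} with (A+BF)𝒱_h ⊆ 𝒱_h, the smallest (A+BF)-invariant subspace containing 𝒱_h ∩ range B equals the largest (A,B)-controlled invariant subspace contained in Σ_{k=0}^{h−1} A^k(range B). -/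
open Matrix Submodule

/-- The pencil subspace `V(λ)`: projection onto the first `n` coordinates of the
kernel of `[A - λI, B]`, i.e. `{x | ∃ u, (A - λI) x + B u = 0}`. -/
noncomputable def pencilSub {n m : ℕ} (A : Matrix (Fin n) (Fin n) ℂ)
    (B : Matrix (Fin n) (Fin m) ℂ) (lam : ℂ) : Submodule ℂ (Fin n → ℂ) :=
  Submodule.map (LinearMap.fst ℂ (Fin n → ℂ) (Fin m → ℂ))
    (LinearMap.ker (((A - lam • 1).mulVecLin).coprod B.mulVecLin))

/-- `λ` is an uncontrollable eigenvalue of `(A, B)` if `(x, u) ↦ (A - λI) x + B u`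
is not surjective. -/
def IsUncontrollableEig {n m : ℕ} (A : Matrix (Fin n) (Fin n) ℂ)
    (B : Matrix (Fin n) (Fin m) ℂ) (lam : ℂ) : Prop :=
  ¬ Function.Surjective (((A - lam • 1).mulVecLin).coprod B.mulVecLin)

/-- The `h`-step Krylov subspace `Σ_{k=0}^{h-1} A^k (range B)`. -/
noncomputable def krylov {n m : ℕ} (A : Matrix (Fin n) (Fin n) ℂ)
    (B : Matrix (Fin n) (Fin m) ℂ) (h : ℕ) : Submodule ℂ (Fin n → ℂ) :=
  ⨆ k ∈ Finset.range h, Submodule.map (A.mulVecLin ^ k) (LinearMap.range B.mulVecLin)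

/-- `𝒱` is `(A,B)`-controlled invariant: `A 𝒱 ⊆ 𝒱 + range B`. -/
def IsControlledInvariant {n m : ℕ} (A : Matrix (Fin n) (Fin n) ℂ)
    (B : Matrix (Fin n) (Fin m) ℂ) (V : Submodule ℂ (Fin n → ℂ)) : Prop :=
  Submodule.map A.mulVecLin V ≤ V ⊔ LinearMap.range B.mulVecLin

open Polynomial

section Krylov

variable {K M : Type*} [Field K] [AddCommGroup M] [Module K M]

/-- The subspace `Σ_{k<h} a^k (b)` for an endomorphism `a` and a subspace `b`. -/
def krylovSpace (a : Module.End K M) (b : Submodule K M) (h : ℕ) : Submodule K M :=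
  ⨆ k ∈ Finset.range h, b.map (a ^ k)

theorem krylovSpace_zero (a : Module.End K M) (b : Submodule K M) :
    krylovSpace a b 0 = ⊥ := by
  simp [krylovSpace]

theorem krylovSpace_succ (a : Module.End K M) (b : Submodule K M) (h : ℕ) :
    krylovSpace a b (h + 1) = b.map (a ^ h) ⊔ krylovSpace a b h := by
  rw [krylovSpace, Finset.range_add_one, Finset.iSup_insert, krylovSpace]

theorem krylovSpace_mono (a : Module.End K M) (b : Submodule K M) :
    Monotone (krylovSpace a b) :=
  monotone_nat_of_le_succ fun h => by rw [krylovSpace_succ]; exact le_sup_right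

theorem krylovSpace_succ' (a : Module.End K M) (b : Submodule K M) (h : ℕ) :
    krylovSpace a b (h + 1) = b ⊔ (krylovSpace a b h).map a := by
  induction h with
  | zero => simp [krylovSpace_succ, krylovSpace_zero, Module.End.one_eq_id]
  | succ h ih =>
    rw [krylovSpace_succ, ih, sup_left_comm, pow_succ', Module.End.mul_eq_comp,
      Submodule.map_comp, ← Submodule.map_sup, ← krylovSpace_succ, ih]

theorem map_krylovSpace_le (a : Module.End K M) (b : Submodule K M) (h : ℕ) :
    (krylovSpace a b h).map a ≤ krylovSpace a b (h + 1) := by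
  rw [krylovSpace_succ']; exact le_sup_right

theorem pow_apply_mem_krylovSpace {a : Module.End K M} {b : Submodule K M} {h : ℕ} {x : M}
    (hx : x ∈ krylovSpace a b h) (k : ℕ) : (a ^ k) x ∈ krylovSpace a b (h + k) := by
  induction k with
  | zero => simpa using hx
  | succ k ih =>
    rw [pow_succ', Module.End.mul_apply]
    exact map_krylovSpace_le a b (h + k) (Submodule.mem_map_of_mem ih)

theorem pow_apply_mem_krylovSpace_of_lt {a : Module.End K M} {b : Submodule K M} {h k : ℕ}
    (hk : k < h) {x : M} (hx : x ∈ b) : (a ^ k) x ∈ krylovSpace a b h := by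
  refine krylovSpace_mono a b hk ?_
  rw [krylovSpace_succ]
  exact Submodule.mem_sup_left (Submodule.mem_map_of_mem hx)

theorem aeval_apply_mem_krylovSpace {a : Module.End K M} {b : Submodule K M} {h : ℕ}
    {q : K[X]} (hq : q.degree < h) {x : M} (hx : x ∈ b) :
    aeval a q x ∈ krylovSpace a b h := by
  rcases eq_or_ne q 0 with rfl | hq0
  · simp
  · have hlt : q.natDegree < h := (natDegree_lt_iff_degree_lt hq0).2 hq
    rw [aeval_eq_sum_range' hlt, LinearMap.sum_apply]
    refine Submodule.sum_mem _ fun k hk => ?_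
    exact Submodule.smul_mem _ _ (pow_apply_mem_krylovSpace_of_lt (Finset.mem_range.1 hk) hx)

theorem degree_sub_X_pow_lt {p : K[X]} {h : ℕ} (hp : p.Monic) (hdeg : p.natDegree = h) :
    (p - X ^ h).degree < (h : WithBot ℕ) := by
  have hpd : p.degree = h := by rw [degree_eq_natDegree hp.ne_zero, hdeg]
  rw [← hpd]
  exact degree_sub_lt_left (by rw [hpd, degree_X_pow]) hp.ne_zero
    (by rw [hp.leadingCoeff, (monic_X_pow h).leadingCoeff])

/-- Modulo the `h`-step Krylov subspace, a monic polynomial of degree `h` in `a` acts on `b`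
as `a ^ h`. -/
theorem aeval_sub_pow_apply_mem_krylovSpace {a : Module.End K M} {b : Submodule K M} {h : ℕ}
    {p : K[X]} (hp : p.Monic) (hdeg : p.natDegree = h) {x : M} (hx : x ∈ b) :
    aeval a p x - (a ^ h) x ∈ krylovSpace a b h := by
  simpa using aeval_apply_mem_krylovSpace (a := a) (degree_sub_X_pow_lt hp hdeg) hx

/-- Krylov subspaces do not grow under a perturbation of `a` with range in `b`. -/
theorem krylovSpace_le_of_sub_mem {a a' : Module.End K M} {b : Submodule K M}
    (haa : ∀ x, a x - a' x ∈ b) (h : ℕ) : krylovSpace a b h ≤ krylovSpace a' b h := by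
  induction h with
  | zero => simp [krylovSpace_zero]
  | succ h ih =>
    rw [krylovSpace_succ', krylovSpace_succ']
    refine sup_le le_sup_left ?_
    rintro _ ⟨x, hx, rfl⟩
    rw [← sub_add_cancel (a x) (a' x)]
    exact Submodule.add_mem_sup (haa x) (Submodule.mem_map_of_mem (ih hx))

/-- If `W` is controlled invariant, then `a ^ k` maps `W` into `W` plus the `k`-step Krylov
subspace. -/
theorem pow_apply_mem_sup_krylovSpace {a : Module.End K M} {b W : Submodule K M}
    (hW : W.map a ≤ W ⊔ b) (k : ℕ) {x : M} (hx : x ∈ W) :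
    (a ^ k) x ∈ W ⊔ krylovSpace a b k := by
  induction k with
  | zero => simpa [krylovSpace_zero] using hx
  | succ k ih =>
    rw [pow_succ', Module.End.mul_apply]
    have hle : (W ⊔ krylovSpace a b k).map a ≤ W ⊔ krylovSpace a b (k + 1) := by
      rw [Submodule.map_sup, krylovSpace_succ', ← sup_assoc]
      exact sup_le_sup_right hW _
    exact hle (Submodule.mem_map_of_mem ih)

/-- The subspace of all `x` with `(a - l) x ∈ b`. -/
def eigenPreimage (a : Module.End K M) (b : Submodule K M) (l : K) : Submodule K M :=
  b.comap (a - algebraMap K _ l)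

theorem mem_eigenPreimage {a : Module.End K M} {b : Submodule K M} {l : K} {x : M} :
    x ∈ eigenPreimage a b l ↔ a x - l • x ∈ b := by
  simp [eigenPreimage, Module.algebraMap_end_apply]

/-- Modulo `b`, the map `a - l` is onto the sum of the pencil subspaces at points
different from `l`. -/
theorem exists_sub_smul_sub_mem {ι : Type*} (a : Module.End K M) (b : Submodule K M)
    (lam : ι → K) (s : Finset ι) (l : K) (hl : ∀ i ∈ s, lam i ≠ l) {v : M}
    (hv : v ∈ ⨆ i ∈ s, eigenPreimage a b (lam i)) :
    ∃ w ∈ ⨆ i ∈ s, eigenPreimage a b (lam i), a w - l • w - v ∈ b := by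
  set S := ⨆ i ∈ s, eigenPreimage a b (lam i)
  suffices hle : S ≤ S.map (a - algebraMap K _ l) ⊔ b by
    obtain ⟨_, ⟨w, hw, rfl⟩, c, hc, hwc⟩ := Submodule.mem_sup.1 (hle hv)
    refine ⟨w, hw, ?_⟩
    rw [← hwc]
    simpa [Module.algebraMap_end_apply] using hc
  refine (iSup₂_le fun i hi x hx => ?_ : ⨆ i ∈ s, eigenPreimage a b (lam i) ≤ _)
  have hne : lam i - l ≠ 0 := sub_ne_zero.2 (hl i hi)
  have hxS : x ∈ S := (le_iSup₂_of_le (f := fun i _ => eigenPreimage a b (lam i)) i hi le_rfl) hx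
  have hxb := mem_eigenPreimage.1 hx
  have hdecomp : x = (lam i - l)⁻¹ • (a - algebraMap K _ l) x
      + (-(lam i - l)⁻¹) • (a x - lam i • x) := by
    have : (a - algebraMap K (Module.End K M) l) x - (a x - lam i • x) = (lam i - l) • x := by
      simp only [LinearMap.sub_apply, Module.algebraMap_end_apply, sub_smul]
      abel
    rw [neg_smul, ← sub_eq_add_neg, ← smul_sub, this, smul_smul, inv_mul_cancel₀ hne, one_smul]
  rw [hdecomp]
  exact Submodule.add_mem_sup (Submodule.smul_mem _ _ (Submodule.mem_map_of_mem hxS))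
    (Submodule.smul_mem _ _ hxb)

/-- The sum of the pencil subspaces at distinct points is the preimage of the Krylov subspace
under the polynomial in `a` with these points as roots. -/
theorem iSup_eigenPreimage_eq_comap {ι : Type*} (a : Module.End K M)
    (b : Submodule K M) {lam : ι → K} (hlam : Function.Injective lam) (s : Finset ι) :
    ⨆ i ∈ s, eigenPreimage a b (lam i) =
      (krylovSpace a b s.card).comap (aeval a (∏ i ∈ s, (X - C (lam i)))) := by
  classical
  apply le_antisymm
  · refine iSup₂_le fun i hi x hx => ?_
    rw [Submodule.mem_comap, ← Finset.prod_erase_mul s _ hi, map_mul, Module.End.mul_apply]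
    refine aeval_apply_mem_krylovSpace ?_ (by simpa [mem_eigenPreimage] using hx)
    rw [degree_prod]
    simp only [degree_X_sub_C, Finset.sum_const, Finset.card_erase_of_mem hi, nsmul_one]
    have := Finset.card_pos.2 ⟨i, hi⟩
    exact_mod_cast Nat.sub_lt this one_pos
  · induction s using Finset.induction_on with
    | empty => intro x hx; simpa [krylovSpace_zero] using hx
    | insert i s hi ih =>
      intro x hx
      rw [Submodule.mem_comap, Finset.prod_insert hi, mul_comm, map_mul, Module.End.mul_apply,
        Finset.card_insert_of_notMem hi, krylovSpace_succ] at hx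
      obtain ⟨_, ⟨c, hc, rfl⟩, y, hy, hcy⟩ := Submodule.mem_sup.1 hx
      have hmonic : (∏ i ∈ s, (X - C (lam i))).Monic :=
        monic_prod_of_monic _ _ fun i _ => monic_X_sub_C _
      have hdeg : (∏ i ∈ s, (X - C (lam i))).natDegree = s.card := by
        rw [natDegree_prod_of_monic _ _ fun i _ => monic_X_sub_C _]; simp
      have hv : a x - lam i • x - c ∈ ⨆ j ∈ s, eigenPreimage a b (lam j) := by
        apply ih
        have hsub := aeval_sub_pow_apply_mem_krylovSpace (a := a) hmonic hdeg hc
        have hax : a x - lam i • x = aeval a (X - C (lam i)) x := by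
          simp [Module.algebraMap_end_apply]
        rw [Submodule.mem_comap, map_sub, hax, ← hcy]
        have := Submodule.sub_mem _ hy hsub
        convert this using 1
        abel
      obtain ⟨w, hw, hwb⟩ := exists_sub_smul_sub_mem a b lam s (lam i)
        (fun j hj hji => hi (hlam hji ▸ hj)) hv
      rw [Finset.iSup_insert, ← sub_add_cancel x w]
      refine Submodule.add_mem_sup (mem_eigenPreimage.2 ?_) hw
      have := Submodule.sub_mem _ hc hwb
      convert this using 1
      rw [map_sub, smul_sub]
      abel

/-- If `V` is invariant and a monic polynomial of degree `h` in `a` maps it into the `h`-step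
Krylov subspace, then the invariant subspace generated by `V ⊓ b` lies in the `h`-step
Krylov subspace. -/
theorem sInf_invariant_le_krylovSpace {a : Module.End K M} {b V : Submodule K M} {h : ℕ}
    {p : K[X]} (hp : p.Monic) (hdeg : p.natDegree = h) (hinv : ∀ x ∈ V, a x ∈ V)
    (hV : V ≤ (krylovSpace a b h).comap (aeval a p)) :
    sInf {W : Submodule K M | V ⊓ b ≤ W ∧ W.map a ≤ W} ≤ krylovSpace a b h := by
  refine sInf_le_of_le (b := ⨅ k : ℕ, (krylovSpace a b h).comap (a ^ k)) ⟨?_, ?_⟩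
    (iInf_le_of_le 0 ?_)
  · refine le_iInf fun k x hx => ?_
    have hdiv : a ^ k = aeval a (X ^ k %ₘ p) + aeval a p * aeval a (X ^ k /ₘ p) := by
      rw [← map_mul, ← map_add, modByMonic_add_div, map_pow, aeval_X]
    rw [Submodule.mem_comap, hdiv, LinearMap.add_apply, Module.End.mul_apply]
    refine Submodule.add_mem _ (aeval_apply_mem_krylovSpace ?_ hx.2) (hV ?_)
    · rw [← hdeg, ← degree_eq_natDegree hp.ne_zero]
      exact degree_modByMonic_lt _ hp
    · rw [aeval_eq_sum_range, LinearMap.sum_apply]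
      refine Submodule.sum_mem _ fun j _ => Submodule.smul_mem _ _ ?_
      exact Module.End.pow_apply_mem_of_forall_mem j hinv x hx.1
  · rintro _ ⟨x, hx, rfl⟩
    rw [Submodule.mem_iInf]
    intro k
    have := (Submodule.mem_iInf _).1 hx (k + 1)
    rwa [Submodule.mem_comap, pow_succ, Module.End.mul_apply] at this
  · intro x hx
    simpa using hx

/-- If `V` is invariant and is the preimage of the `h`-step Krylov subspace under a monic
polynomial of degree `h` in `a`, then every controlled invariant subspace of that Krylov
subspace lies in every invariant subspace between `V ⊓ b` and it. -/
theorem controlledInvariant_le_of_invariant {a : Module.End K M} {b V R W : Submodule K M} {h : ℕ}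
    {p : K[X]} (hp : p.Monic) (hdeg : p.natDegree = h) (hinv : ∀ x ∈ V, a x ∈ V)
    (hV : V = (krylovSpace a b h).comap (aeval a p))
    (hVR : V ⊓ b ≤ R) (hR : R.map a ≤ R) (hRK : R ≤ krylovSpace a b h)
    (hW : W.map a ≤ W ⊔ b) (hWK : W ≤ krylovSpace a b h) : W ≤ R := by
  have hWV : W ≤ V := by
    intro x hx
    rw [hV, Submodule.mem_comap, aeval_eq_sum_range, LinearMap.sum_apply]
    refine Submodule.sum_mem _ fun k hk => Submodule.smul_mem _ _ ?_
    have hkh : k ≤ h := by rw [← hdeg]; exact Nat.lt_succ_iff.1 (Finset.mem_range.1 hk)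
    exact sup_le hWK (krylovSpace_mono a b hkh) (pow_apply_mem_sup_krylovSpace hW k hx)
  have hWR : ∀ x ∈ W, a x ∈ W ⊔ R := by
    intro x hx
    obtain ⟨w, hw, c, hc, hwc⟩ := Submodule.mem_sup.1 (hW (Submodule.mem_map_of_mem hx))
    have hcV : c ∈ V := by
      rw [← add_sub_cancel_left w c, hwc]
      exact V.sub_mem (hinv x (hWV hx)) (hWV hw)
    rw [← hwc]
    exact Submodule.add_mem_sup hw (hVR ⟨hcV, hc⟩)
  have hRpow : ∀ k : ℕ, ∀ x ∈ R, (a ^ k) x ∈ R := fun k x hx =>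
    Module.End.pow_apply_mem_of_forall_mem k (fun y hy => hR (Submodule.mem_map_of_mem hy)) x hx
  have descend : ∀ j ≤ h, W ≤ krylovSpace a b (h - j) ⊔ R := by
    intro j
    induction j with
    | zero => exact fun _ => hWK.trans le_sup_left
    | succ j ih =>
      intro hj x hx
      obtain ⟨k, hk⟩ : ∃ k, h = k + 1 + j := ⟨h - (j + 1), by omega⟩
      have ihk : W ≤ krylovSpace a b (k + 1) ⊔ R := by
        have := ih (by omega)
        rwa [show h - j = k + 1 by omega] at this
      rw [show h - (j + 1) = k by omega]
      obtain ⟨z, hz, r, hr, rfl⟩ := Submodule.mem_sup.1 (ihk hx)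
      rw [krylovSpace_succ] at hz
      obtain ⟨_, ⟨c, hc, rfl⟩, y, hy, rfl⟩ := Submodule.mem_sup.1 hz
      have hax := sup_le ihk le_sup_right (hWR _ hx)
      have hac : (a ^ (k + 1)) c ∈ krylovSpace a b (k + 1) ⊔ R := by
        have hay : a y + a r ∈ krylovSpace a b (k + 1) ⊔ R :=
          Submodule.add_mem_sup (map_krylovSpace_le a b k (Submodule.mem_map_of_mem hy))
            (hR (Submodule.mem_map_of_mem hr))
        have := Submodule.sub_mem _ hax hay
        rw [pow_succ', Module.End.mul_apply]
        convert this using 1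
        rw [map_add, map_add]
        abel
      have hhc : (a ^ h) c ∈ krylovSpace a b h := by
        obtain ⟨y', hy', r', hr', hyr⟩ := Submodule.mem_sup.1 hac
        rw [hk, add_comm (k + 1) j, pow_add, Module.End.mul_apply, ← hyr, map_add,
          add_comm j (k + 1)]
        refine Submodule.add_mem _ (pow_apply_mem_krylovSpace hy' j) ?_
        rw [← hk]
        exact hRK (hRpow j r' hr')
      have hcV : c ∈ V := by
        rw [hV, Submodule.mem_comap, ← sub_add_cancel (aeval a p c) ((a ^ h) c)]
        exact Submodule.add_mem _ (aeval_sub_pow_apply_mem_krylovSpace hp hdeg hc) hhc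
      rw [add_comm ((a ^ k) c) y, add_assoc]
      exact Submodule.add_mem_sup hy (R.add_mem (hRpow k c (hVR ⟨hcV, hc⟩)) hr)
  simpa [krylovSpace_zero] using descend h le_rfl

end Krylov

theorem mulVecLin_add_mul_apply {n m : ℕ} (A : Matrix (Fin n) (Fin n) ℂ)
    (B : Matrix (Fin n) (Fin m) ℂ) (F : Matrix (Fin m) (Fin n) ℂ) (x : Fin n → ℂ) :
    (A + B * F).mulVecLin x = A.mulVecLin x + B.mulVecLin (F.mulVecLin x) := by
  simp

theorem pencilSub_eq_eigenPreimage {n m : ℕ} (A : Matrix (Fin n) (Fin n) ℂ)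
    (B : Matrix (Fin n) (Fin m) ℂ) (F : Matrix (Fin m) (Fin n) ℂ) (l : ℂ) :
    pencilSub A B l =
      eigenPreimage (A + B * F).mulVecLin (LinearMap.range B.mulVecLin) l := by
  ext x
  have hx : (A - l • 1).mulVecLin x = A.mulVecLin x - l • x := by
    simp
  rw [mem_eigenPreimage, mulVecLin_add_mul_apply]
  constructor
  · rintro ⟨⟨y, u⟩, hyu, rfl⟩
    rw [SetLike.mem_coe, LinearMap.mem_ker, LinearMap.coprod_apply] at hyu
    simp only [LinearMap.fst_apply] at hx ⊢
    refine ⟨F.mulVecLin y - u, ?_⟩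
    rw [map_sub, eq_neg_of_add_eq_zero_right hyu, hx]
    abel
  · rintro ⟨u, hu⟩
    refine ⟨(x, F.mulVecLin x - u), ?_, rfl⟩
    rw [SetLike.mem_coe, LinearMap.mem_ker, LinearMap.coprod_apply, hx, map_sub, hu]
    abel

theorem krylov_eq_krylovSpace {n m : ℕ} (A : Matrix (Fin n) (Fin n) ℂ)
    (B : Matrix (Fin n) (Fin m) ℂ) (F : Matrix (Fin m) (Fin n) ℂ) (h : ℕ) :
    krylov A B h = krylovSpace (A + B * F).mulVecLin (LinearMap.range B.mulVecLin) h := by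
  change krylovSpace A.mulVecLin _ h = _
  refine le_antisymm (krylovSpace_le_of_sub_mem (fun x => ?_) h)
    (krylovSpace_le_of_sub_mem (fun x => ?_) h)
  · exact ⟨-F.mulVecLin x, by rw [mulVecLin_add_mul_apply, map_neg]; abel⟩
  · exact ⟨F.mulVecLin x, by rw [mulVecLin_add_mul_apply]; abel⟩

theorem isControlledInvariant_iff_feedback {n m : ℕ} (A : Matrix (Fin n) (Fin n) ℂ)
    (B : Matrix (Fin n) (Fin m) ℂ) (F : Matrix (Fin m) (Fin n) ℂ)
    (W : Submodule ℂ (Fin n → ℂ)) :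
    IsControlledInvariant A B W ↔
      W.map (A + B * F).mulVecLin ≤ W ⊔ LinearMap.range B.mulVecLin := by
  simp only [IsControlledInvariant, Submodule.map_le_iff_le_comap]
  refine forall₂_congr fun x _ => ?_
  rw [Submodule.mem_comap, Submodule.mem_comap, mulVecLin_add_mul_apply]
  exact (Submodule.add_mem_iff_left _
    (Submodule.mem_sup_right (LinearMap.mem_range_self _ (F.mulVecLin x)))).symm

theorem isControlledInvariant_iSup_pencilSub {n m : ℕ} {ι : Type*}
    (A : Matrix (Fin n) (Fin n) ℂ) (B : Matrix (Fin n) (Fin m) ℂ) (lam : ι → ℂ) :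
    IsControlledInvariant A B (⨆ i, pencilSub A B (lam i)) := by
  rw [isControlledInvariant_iff_feedback A B 0, Submodule.map_iSup]
  refine iSup_le fun i => ?_
  rintro _ ⟨x, hx, rfl⟩
  have hxb := mem_eigenPreimage.1 (pencilSub_eq_eigenPreimage A B 0 (lam i) ▸ hx)
  rw [← add_sub_cancel (lam i • x) ((A + B * 0 : Matrix _ _ ℂ).mulVecLin x)]
  exact Submodule.add_mem_sup
    (Submodule.smul_mem _ _ (le_iSup (fun i => pencilSub A B (lam i)) i hx)) hxb

theorem reachable_on_sum_pencilSub (n m : ℕ) (hn : 0 < n) (hm : 0 < m)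
    (A : Matrix (Fin n) (Fin n) ℂ) (B : Matrix (Fin n) (Fin m) ℂ)
    (h : ℕ) (hh : 1 ≤ h) (lam : Fin h → ℂ)
    (hdist : Function.Injective lam)
    (hctrl : ∀ i, ¬ IsUncontrollableEig A B (lam i))
    (V : Submodule ℂ (Fin n → ℂ))
    (hV : V = ⨆ i, pencilSub A B (lam i)) :
    IsControlledInvariant A B V ∧
    ∀ F : Matrix (Fin m) (Fin n) ℂ,
      (∀ x ∈ V, (A + B * F).mulVecLin x ∈ V) →
      sInf {W : Submodule ℂ (Fin n → ℂ) |
          V ⊓ LinearMap.range B.mulVecLin ≤ W ∧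
          Submodule.map (A + B * F).mulVecLin W ≤ W} =
        sSup {W : Submodule ℂ (Fin n → ℂ) |
          IsControlledInvariant A B W ∧ W ≤ krylov A B h} := by
  refine ⟨hV ▸ isControlledInvariant_iSup_pencilSub A B lam, fun F hF => ?_⟩
  have hmonic : (∏ i, (X - C (lam i))).Monic := monic_prod_of_monic _ _ fun i _ => monic_X_sub_C _
  have hdeg : (∏ i, (X - C (lam i))).natDegree = h := by
    rw [natDegree_prod_of_monic _ _ fun i _ => monic_X_sub_C _]; simp
  have hVp : V = (krylovSpace (A + B * F).mulVecLin (LinearMap.range B.mulVecLin) h).comap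
      (aeval (A + B * F).mulVecLin (∏ i, (X - C (lam i)))) := by
    have := iSup_eigenPreimage_eq_comap (A + B * F).mulVecLin (LinearMap.range B.mulVecLin)
      hdist Finset.univ
    simpa [hV, pencilSub_eq_eigenPreimage A B F] using this
  have hRK := sInf_invariant_le_krylovSpace hmonic hdeg hF hVp.le
  simp only [isControlledInvariant_iff_feedback A B F, krylov_eq_krylovSpace A B F]
  set R := sInf {W : Submodule ℂ (Fin n → ℂ) |
    V ⊓ LinearMap.range B.mulVecLin ≤ W ∧ Submodule.map (A + B * F).mulVecLin W ≤ W}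
  have hVR : V ⊓ LinearMap.range B.mulVecLin ≤ R := le_sInf fun W hW => hW.1
  have hR : R.map (A + B * F).mulVecLin ≤ R :=
    le_sInf fun W hW => (Submodule.map_mono (sInf_le hW)).trans hW.2
  exact le_antisymm (le_sSup ⟨hR.trans le_sup_left, hRK⟩) (sSup_le fun W hW =>
    controlledInvariant_le_of_invariant hmonic hdeg hF hVp hVR hR hRK hW.1 hW.2)
end
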